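/- Let ρ be a critical radius function, 1 < p < ∞, and c₁ > 2c₂ > 0. If w is a weight such that the centered exponential Hardy–Littlewood maximal operator M_{ρ,c₂} is bounded on L^p(w), then w ∈ S_{p,c₁}^ρ. -/

import Mathlib

open MeasureTheory Metric Set

noncomputable section

/-- A critical radius function with constants `B₀, k₀`. -/
def IsCRF {d : ℕ} (ρ : EuclideanSpace ℝ (Fin d) → ℝ) (B₀ k₀ : ℝ) : Prop :=
  (∀ x, 0 < ρ x) ∧ ∀ x y : EuclideanSpace ℝ (Fin d),
    B₀⁻¹ * ρ x * (1 + dist x y / ρ x) ^ (-k₀) ≤ ρ y ∧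
    ρ y ≤ B₀ * ρ x * (1 + dist x y / ρ x) ^ (k₀ / (k₀ + 1))

/-- The Agmon distance associated to `ρ`. -/
def agmonDist {d : ℕ} (ρ : EuclideanSpace ℝ (Fin d) → ℝ)
    (x y : EuclideanSpace ℝ (Fin d)) : ℝ :=
  sInf { L : ℝ | ∃ γ : ℝ → EuclideanSpace ℝ (Fin d), ContDiff ℝ 1 γ ∧ γ 0 = x ∧ γ 1 = y ∧
    L = ∫ t in (0:ℝ)..1, (ρ (γ t))⁻¹ * ‖deriv γ t‖ }

/-- The Agmon ball `B_ρ(x,r)`. -/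
def agmonBall {d : ℕ} (ρ : EuclideanSpace ℝ (Fin d) → ℝ)
    (x : EuclideanSpace ℝ (Fin d)) (r : ℝ) : Set (EuclideanSpace ℝ (Fin d)) :=
  { y | agmonDist ρ x y < r }

/-- The weight class `S_{p,c}^ρ`: the defining supremum over Agmon balls is finite. -/
def MemS {d : ℕ} (ρ : EuclideanSpace ℝ (Fin d) → ℝ) (p c : ℝ)
    (w : EuclideanSpace ℝ (Fin d) → ℝ) : Prop :=
  ∃ C : ℝ, ∀ (x : EuclideanSpace ℝ (Fin d)) (r : ℝ), 0 < r →
    ((1 / ((volume (agmonBall ρ x r)).toReal * Real.exp (c * r))) *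
        ∫ y in agmonBall ρ x r, w y) ^ (1/p) *
    ((1 / ((volume (agmonBall ρ x r)).toReal * Real.exp (c * r))) *
        ∫ y in agmonBall ρ x r, (w y) ^ (-(p-1)⁻¹)) ^ ((p-1)/p) ≤ C

open scoped ENNReal

/-- Centered exponential Hardy–Littlewood maximal operator `M_{ρ,c}`. -/
def aMax {d : ℕ} (ρ : EuclideanSpace ℝ (Fin d) → ℝ) (c : ℝ)
    (f : EuclideanSpace ℝ (Fin d) → ℝ) (x : EuclideanSpace ℝ (Fin d)) : ℝ≥0∞ :=
  ⨆ (t : ℝ) (_ : 0 < t),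
    (∫⁻ y in agmonBall ρ x t, ENNReal.ofReal |f y|) /
      (volume (agmonBall ρ x t) * ENNReal.ofReal (Real.exp (c * t)))

/-- Uncentered exponential Hardy–Littlewood maximal operator `ℳ_{ρ,c}`. -/
def aMaxUnc {d : ℕ} (ρ : EuclideanSpace ℝ (Fin d) → ℝ) (c : ℝ)
    (f : EuclideanSpace ℝ (Fin d) → ℝ) (x : EuclideanSpace ℝ (Fin d)) : ℝ≥0∞ :=
  ⨆ (z : EuclideanSpace ℝ (Fin d)) (r : ℝ) (_ : 0 < r) (_ : agmonDist ρ z x < r),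
    (∫⁻ y in agmonBall ρ z r, ENNReal.ofReal |f y|) /
      (volume (agmonBall ρ z r) * ENNReal.ofReal (Real.exp (c * r)))

/-- The Agmon length element of a curve. -/
def agmonSpeed {d : ℕ} (ρ : EuclideanSpace ℝ (Fin d) → ℝ) (γ : ℝ → EuclideanSpace ℝ (Fin d))
    (t : ℝ) : ℝ :=
  (ρ (γ t))⁻¹ * ‖deriv γ t‖

lemma strictMonoOn_smoothTransition : StrictMonoOn Real.smoothTransition (Ioo 0 1) := by
  intro x hx y hy hxy
  have key : ∀ {u v : ℝ}, 0 < u → u < v → expNegInvGlue u < expNegInvGlue v := by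
    intro u v hu huv
    simp only [expNegInvGlue, not_le.2 hu, not_le.2 (hu.trans huv), if_false]
    apply Real.exp_lt_exp.2
    have := inv_strictAnti₀ hu huv
    linarith
  have h1 := key hx.1 hxy
  have h2 := key (u := 1 - y) (v := 1 - x) (by linarith [hy.2]) (by linarith)
  have px := expNegInvGlue.pos_of_pos hx.1
  have py := expNegInvGlue.pos_of_pos (x := 1 - y) (by linarith [hy.2])
  unfold Real.smoothTransition
  rw [div_lt_div_iff₀ (by linarith) (by linarith)]
  nlinarith

lemma image_smoothTransition_Ioo (a : ℝ) :
    (fun t : ℝ => Real.smoothTransition (2 * (t - a))) '' Ioo a (a + 1 / 2) = Ioo 0 1 := by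
  apply Subset.antisymm
  · rintro _ ⟨t, ht, rfl⟩
    exact ⟨Real.smoothTransition.pos_of_pos (by linarith [ht.1]),
      Real.smoothTransition.lt_one_of_lt_one (by linarith [ht.2])⟩
  · have h := intermediate_value_Ioo (a := a) (b := a + 1 / 2) (by linarith)
      (f := fun t : ℝ => Real.smoothTransition (2 * (t - a)))
      (Real.smoothTransition.continuous.comp (by fun_prop)).continuousOn
    have e : 2 * (a + 1 / 2 - a) = 1 := by ring
    simpa [e] using h

lemma agmonSpeed_reparam {d : ℕ} (ρ : EuclideanSpace ℝ (Fin d) → ℝ)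
    {γ Γ : ℝ → EuclideanSpace ℝ (Fin d)} (hγ : Differentiable ℝ γ) (a : ℝ)
    (h : ∀ t ∈ Ioo a (a + 1 / 2), Γ t = γ (Real.smoothTransition (2 * (t - a)))) :
    (IntegrableOn (agmonSpeed ρ Γ) (Ioo a (a + 1 / 2)) ↔
      IntegrableOn (agmonSpeed ρ γ) (Ioo 0 1)) ∧
    ∫ t in Ioo a (a + 1 / 2), agmonSpeed ρ Γ t = ∫ t in Ioo 0 1, agmonSpeed ρ γ t := by
  set g : ℝ → ℝ := fun t => Real.smoothTransition (2 * (t - a)) with hg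
  have hgd : Differentiable ℝ g :=
    ((Real.smoothTransition.contDiff (n := 1)).differentiable (by simp)).comp (by fun_prop)
  have hinj : InjOn g (Ioo a (a + 1 / 2)) := by
    intro x hx y hy hxy
    have := strictMonoOn_smoothTransition.injOn (x₁ := 2 * (x - a)) (x₂ := 2 * (y - a))
      ⟨by linarith [hx.1], by linarith [hx.2]⟩ ⟨by linarith [hy.1], by linarith [hy.2]⟩ hxy
    linarith
  have heq : EqOn (agmonSpeed ρ Γ) (fun t => |deriv g t| • agmonSpeed ρ γ (g t))
      (Ioo a (a + 1 / 2)) := by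
    intro t ht
    have hev : Γ =ᶠ[nhds t] γ ∘ g := by
      filter_upwards [isOpen_Ioo.mem_nhds ht] with u hu using h u hu
    have hd : deriv Γ t = deriv g t • deriv γ (g t) := by
      rw [hev.deriv_eq]
      exact ((hγ (g t)).hasDerivAt.scomp t (hgd t).hasDerivAt).deriv
    simp only [agmonSpeed, hd, h t ht, norm_smul, Real.norm_eq_abs, smul_eq_mul]
    ring
  have hd' : ∀ t ∈ Ioo a (a + 1 / 2), HasDerivWithinAt g (deriv g t) (Ioo a (a + 1 / 2)) t :=
    fun t _ => (hgd t).hasDerivAt.hasDerivWithinAt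
  have h1 := integrableOn_image_iff_integrableOn_abs_deriv_smul measurableSet_Ioo hd' hinj
    (agmonSpeed ρ γ)
  have h2 := integral_image_eq_integral_abs_deriv_smul measurableSet_Ioo hd' hinj
    (agmonSpeed ρ γ)
  rw [image_smoothTransition_Ioo] at h1 h2
  exact ⟨(integrableOn_congr_fun heq measurableSet_Ioo).trans h1.symm,
    (setIntegral_congr_fun measurableSet_Ioo heq).trans h2.symm⟩

lemma exists_concat {d : ℕ} (ρ : EuclideanSpace ℝ (Fin d) → ℝ)
    {γ₁ γ₂ : ℝ → EuclideanSpace ℝ (Fin d)} (h₁ : ContDiff ℝ 1 γ₁) (h₂ : ContDiff ℝ 1 γ₂)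
    (h : γ₁ 1 = γ₂ 0) :
    ∃ Γ : ℝ → EuclideanSpace ℝ (Fin d), ContDiff ℝ 1 Γ ∧ Γ 0 = γ₁ 0 ∧ Γ 1 = γ₂ 1 ∧
      (IntegrableOn (agmonSpeed ρ Γ) (Ioo 0 1) ↔
        IntegrableOn (agmonSpeed ρ γ₁) (Ioo 0 1) ∧ IntegrableOn (agmonSpeed ρ γ₂) (Ioo 0 1)) ∧
      (IntegrableOn (agmonSpeed ρ Γ) (Ioo 0 1) →
        ∫ t in Ioo 0 1, agmonSpeed ρ Γ t =
          (∫ t in Ioo 0 1, agmonSpeed ρ γ₁ t) + ∫ t in Ioo 0 1, agmonSpeed ρ γ₂ t) := by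
  have hs : ContDiff ℝ 1 Real.smoothTransition := Real.smoothTransition.contDiff
  set Γ : ℝ → EuclideanSpace ℝ (Fin d) := fun t =>
    γ₁ (Real.smoothTransition (2 * (t - 0))) + γ₂ (Real.smoothTransition (2 * (t - 1 / 2))) - γ₂ 0
    with hΓ
  have e₁ : ∀ t ∈ Ioo (0 : ℝ) (0 + 1 / 2), Γ t = γ₁ (Real.smoothTransition (2 * (t - 0))) := by
    intro t ht
    have : Real.smoothTransition (2 * (t - 1 / 2)) = 0 :=
      Real.smoothTransition.zero_of_nonpos (by linarith [ht.2])
    simp only [hΓ, this]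
    abel
  have e₂ : ∀ t ∈ Ioo (1 / 2 : ℝ) (1 / 2 + 1 / 2),
      Γ t = γ₂ (Real.smoothTransition (2 * (t - 1 / 2))) := by
    intro t ht
    have : Real.smoothTransition (2 * (t - 0)) = 1 :=
      Real.smoothTransition.one_of_one_le (by linarith [ht.1])
    simp only [hΓ, this, h]
    abel
  obtain ⟨i₁, l₁⟩ := agmonSpeed_reparam ρ (h₁.differentiable (by simp)) 0 e₁
  obtain ⟨i₂, l₂⟩ := agmonSpeed_reparam ρ (h₂.differentiable (by simp)) (1 / 2) e₂
  norm_num only at i₁ l₁ i₂ l₂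
  have hu : Ioc (0 : ℝ) (1 / 2) ∪ Ioc (1 / 2) 1 = Ioc 0 1 :=
    Ioc_union_Ioc_eq_Ioc (by norm_num) (by norm_num)
  have hint : IntegrableOn (agmonSpeed ρ Γ) (Ioo 0 1) ↔
      IntegrableOn (agmonSpeed ρ Γ) (Ioc 0 (1 / 2)) ∧
        IntegrableOn (agmonSpeed ρ Γ) (Ioc (1 / 2) 1) := by
    rw [← integrableOn_Ioc_iff_integrableOn_Ioo, ← hu, integrableOn_union]
  refine ⟨Γ, ?_, ?_, ?_, ?_, ?_⟩
  · exact ((h₁.comp (hs.comp (by fun_prop))).add (h₂.comp (hs.comp (by fun_prop)))).sub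
      contDiff_const
  · simp [hΓ, Real.smoothTransition.zero_of_nonpos]
  · have : Real.smoothTransition (2 * (1 - 1 / 2)) = 1 :=
      Real.smoothTransition.one_of_one_le (by norm_num)
    have h' : Real.smoothTransition (2 * (1 - 0)) = 1 :=
      Real.smoothTransition.one_of_one_le (by norm_num)
    simp only [hΓ, this, h', h]
    abel
  · rw [hint, integrableOn_Ioc_iff_integrableOn_Ioo, integrableOn_Ioc_iff_integrableOn_Ioo, i₁, i₂]
  · intro hi
    obtain ⟨ha, hb⟩ := hint.1 hi
    rw [← l₁, ← l₂, ← integral_Ioc_eq_integral_Ioo, ← integral_Ioc_eq_integral_Ioo,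
      ← integral_Ioc_eq_integral_Ioo, ← hu,
      setIntegral_union (Ioc_disjoint_Ioc_of_le le_rfl) measurableSet_Ioc ha hb]

lemma contDiff_lineMap {d : ℕ} (x y : EuclideanSpace ℝ (Fin d)) :
    ContDiff ℝ 1 (AffineMap.lineMap x y : ℝ → EuclideanSpace ℝ (Fin d)) := by
  have : (AffineMap.lineMap x y : ℝ → EuclideanSpace ℝ (Fin d)) = fun t => t • (y - x) + x := by
    ext1 t
    simp [AffineMap.lineMap_apply]
  rw [this]
  fun_prop

lemma integral_agmonSpeed {d : ℕ} (ρ : EuclideanSpace ℝ (Fin d) → ℝ)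
    (γ : ℝ → EuclideanSpace ℝ (Fin d)) :
    ∫ t in (0:ℝ)..1, (ρ (γ t))⁻¹ * ‖deriv γ t‖ = ∫ t in Ioo 0 1, agmonSpeed ρ γ t := by
  rw [intervalIntegral.integral_of_le zero_le_one, integral_Ioc_eq_integral_Ioo]
  rfl

lemma agmonSpeed_nonneg {d : ℕ} {ρ : EuclideanSpace ℝ (Fin d) → ℝ} (hpos : ∀ x, 0 < ρ x)
    (γ : ℝ → EuclideanSpace ℝ (Fin d)) (t : ℝ) : 0 ≤ agmonSpeed ρ γ t :=
  mul_nonneg (inv_nonneg.2 (hpos _).le) (norm_nonneg _)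

lemma integral_agmonSpeed_nonneg {d : ℕ} {ρ : EuclideanSpace ℝ (Fin d) → ℝ}
    (hpos : ∀ x, 0 < ρ x) (γ : ℝ → EuclideanSpace ℝ (Fin d)) :
    0 ≤ ∫ t in Ioo 0 1, agmonSpeed ρ γ t :=
  integral_nonneg fun t => agmonSpeed_nonneg hpos γ t

lemma agmonDist_nonneg {d : ℕ} {ρ : EuclideanSpace ℝ (Fin d) → ℝ}
    (hpos : ∀ x, 0 < ρ x) (x y : EuclideanSpace ℝ (Fin d)) : 0 ≤ agmonDist ρ x y := by
  refine Real.sInf_nonneg ?_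
  rintro _ ⟨γ, -, -, -, rfl⟩
  rw [integral_agmonSpeed]
  exact integral_agmonSpeed_nonneg hpos γ

lemma agmonDist_le_integral {d : ℕ} {ρ : EuclideanSpace ℝ (Fin d) → ℝ}
    (hpos : ∀ x, 0 < ρ x) {γ : ℝ → EuclideanSpace ℝ (Fin d)} (hγ : ContDiff ℝ 1 γ) :
    agmonDist ρ (γ 0) (γ 1) ≤ ∫ t in Ioo 0 1, agmonSpeed ρ γ t := by
  refine csInf_le ⟨0, ?_⟩ ⟨γ, hγ, rfl, rfl, (integral_agmonSpeed ρ γ).symm⟩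
  rintro _ ⟨γ, -, -, -, rfl⟩
  rw [integral_agmonSpeed]
  exact integral_agmonSpeed_nonneg hpos γ

lemma exists_curve_of_agmonDist_lt {d : ℕ} {ρ : EuclideanSpace ℝ (Fin d) → ℝ}
    {x y : EuclideanSpace ℝ (Fin d)} {r : ℝ} (h : agmonDist ρ x y < r) :
    ∃ γ : ℝ → EuclideanSpace ℝ (Fin d), ContDiff ℝ 1 γ ∧ γ 0 = x ∧ γ 1 = y ∧
      ∫ t in Ioo 0 1, agmonSpeed ρ γ t < r := by
  have hne : { L : ℝ | ∃ γ : ℝ → EuclideanSpace ℝ (Fin d), ContDiff ℝ 1 γ ∧ γ 0 = x ∧ γ 1 = y ∧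
      L = ∫ t in (0:ℝ)..1, (ρ (γ t))⁻¹ * ‖deriv γ t‖ }.Nonempty :=
    ⟨_, AffineMap.lineMap x y, contDiff_lineMap _ _, by simp, by simp, rfl⟩
  obtain ⟨_, ⟨γ, hγ, h0, h1, rfl⟩, hlt⟩ := exists_lt_of_csInf_lt hne h
  exact ⟨γ, hγ, h0, h1, by rwa [← integral_agmonSpeed]⟩

lemma agmonDist_le_swap {d : ℕ} {ρ : EuclideanSpace ℝ (Fin d) → ℝ} (hpos : ∀ x, 0 < ρ x)
    (x y : EuclideanSpace ℝ (Fin d)) : agmonDist ρ y x ≤ agmonDist ρ x y := by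
  refine le_of_forall_gt fun r hr => ?_
  obtain ⟨γ, hγ, rfl, rfl, hlt⟩ := exists_curve_of_agmonDist_lt hr
  have hc : ContDiff ℝ 1 fun t => γ (1 - t) := hγ.comp (by fun_prop)
  have h := agmonDist_le_integral hpos hc
  have e : ∫ t in Ioo 0 1, agmonSpeed ρ (fun t => γ (1 - t)) t =
      ∫ t in Ioo 0 1, agmonSpeed ρ γ t := by
    rw [← integral_agmonSpeed, ← integral_agmonSpeed]
    have := intervalIntegral.integral_comp_sub_left (a := 0) (b := 1)
      (fun t => (ρ (γ t))⁻¹ * ‖deriv γ t‖) 1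
    simpa [deriv_comp_const_sub] using this
  rw [e] at h
  simp only [sub_self, sub_zero] at h
  linarith

lemma agmonDist_comm {d : ℕ} {ρ : EuclideanSpace ℝ (Fin d) → ℝ} (hpos : ∀ x, 0 < ρ x)
    (x y : EuclideanSpace ℝ (Fin d)) : agmonDist ρ x y = agmonDist ρ y x :=
  le_antisymm (agmonDist_le_swap hpos y x) (agmonDist_le_swap hpos x y)

lemma agmonDist_triangle {d : ℕ} {ρ : EuclideanSpace ℝ (Fin d) → ℝ} (hpos : ∀ x, 0 < ρ x)
    (hint : ∀ γ : ℝ → EuclideanSpace ℝ (Fin d), ContDiff ℝ 1 γ →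
      IntegrableOn (agmonSpeed ρ γ) (Ioo 0 1))
    (x y z : EuclideanSpace ℝ (Fin d)) :
    agmonDist ρ x z ≤ agmonDist ρ x y + agmonDist ρ y z := by
  refine le_of_forall_pos_le_add fun ε hε => ?_
  obtain ⟨γ₁, h₁, rfl, h₁y, l₁⟩ := exists_curve_of_agmonDist_lt
    (show agmonDist ρ x y < agmonDist ρ x y + ε / 2 by linarith)
  obtain ⟨γ₂, h₂, rfl, rfl, l₂⟩ := exists_curve_of_agmonDist_lt
    (show agmonDist ρ y z < agmonDist ρ y z + ε / 2 by linarith)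
  obtain ⟨Γ, hΓ, h0, h1, -, hl⟩ := exists_concat ρ h₁ h₂ h₁y
  have h := agmonDist_le_integral hpos hΓ
  rw [hl (hint Γ hΓ), h0, h1] at h
  linarith

/-- If the length element of a single `C¹` curve fails to be integrable, then every two points are
joined by such a curve, and the Agmon distance vanishes identically. -/
lemma agmonDist_eq_zero {d : ℕ} {ρ : EuclideanSpace ℝ (Fin d) → ℝ} (hpos : ∀ x, 0 < ρ x)
    {γ : ℝ → EuclideanSpace ℝ (Fin d)} (hγ : ContDiff ℝ 1 γ)
    (hn : ¬ IntegrableOn (agmonSpeed ρ γ) (Ioo 0 1)) (x y : EuclideanSpace ℝ (Fin d)) :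
    agmonDist ρ x y = 0 := by
  refine le_antisymm ?_ (agmonDist_nonneg hpos x y)
  obtain ⟨Γ₁, h₁, h₁0, h₁1, i₁, -⟩ := exists_concat ρ
    (γ₁ := AffineMap.lineMap x (γ 0)) (contDiff_lineMap _ _) hγ (by simp)
  obtain ⟨Γ, h, h0, h1, i, -⟩ := exists_concat ρ
    (γ₂ := AffineMap.lineMap (γ 1) y) h₁ (contDiff_lineMap _ _) (by simp [h₁1])
  have hni : ¬ IntegrableOn (agmonSpeed ρ Γ) (Ioo 0 1) := fun hi => hn (i₁.1 (i.1 hi).1).2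
  have hle := agmonDist_le_integral hpos h
  rw [integral_undef hni, h0, h1, h₁0] at hle
  simpa using hle

lemma agmonDist_le_of_dist_le {d : ℕ} {ρ : EuclideanSpace ℝ (Fin d) → ℝ} {B₀ k₀ : ℝ}
    (hB₀ : 1 < B₀) (hk₀ : 1 < k₀) (hρ : IsCRF ρ B₀ k₀) {x y : EuclideanSpace ℝ (Fin d)}
    (hxy : dist x y ≤ ρ x) : agmonDist ρ x y ≤ B₀ * 2 ^ k₀ * (dist x y / ρ x) := by
  have hx := hρ.1 x
  have hbound : ∀ z, dist x z ≤ ρ x → (ρ z)⁻¹ ≤ B₀ * 2 ^ k₀ / ρ x := by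
    intro z hz
    have h2 : (2 : ℝ) ^ (-k₀) ≤ (1 + dist x z / ρ x) ^ (-k₀) := by
      apply Real.rpow_le_rpow_of_nonpos
      · have := dist_nonneg (x := x) (y := z)
        positivity
      · have := (div_le_one hx).2 hz
        linarith
      · linarith
    have h3 : B₀⁻¹ * ρ x * 2 ^ (-k₀) ≤ ρ z :=
      le_trans (mul_le_mul_of_nonneg_left h2 (by positivity)) (hρ.2 x z).1
    refine (inv_anti₀ (by positivity) h3).trans (le_of_eq ?_)
    rw [Real.rpow_neg (by norm_num)]
    field_simp
  set γ : ℝ → EuclideanSpace ℝ (Fin d) :=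
    ⇑(AffineMap.lineMap x y : ℝ →ᵃ[ℝ] EuclideanSpace ℝ (Fin d)) with hγ
  have hc : ContDiff ℝ 1 γ := contDiff_lineMap _ _
  have hle := agmonDist_le_integral hρ.1 hc
  have hd : ∀ t, ‖deriv γ t‖ = dist x y := by
    intro t
    have h' : HasDerivAt γ (y - x) t := AffineMap.hasDerivAt_lineMap
    rw [h'.deriv, dist_comm, dist_eq_norm]
  have hm : ‖∫ t in Ioo (0:ℝ) 1, agmonSpeed ρ γ t‖ ≤
      (B₀ * 2 ^ k₀ / ρ x * dist x y) * volume.real (Ioo (0:ℝ) 1) := by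
    refine norm_setIntegral_le_of_norm_le_const (by simp) fun t ht => ?_
    rw [Real.norm_of_nonneg (agmonSpeed_nonneg hρ.1 _ _), agmonSpeed, hd]
    refine mul_le_mul_of_nonneg_right (hbound _ ?_) dist_nonneg
    rw [hγ, dist_left_lineMap (𝕜 := ℝ) x y t, Real.norm_of_nonneg ht.1.le]
    exact (mul_le_of_le_one_left dist_nonneg ht.2.le).trans hxy
  have := (le_abs_self _).trans hm
  rw [Real.volume_real_Ioo_of_le zero_le_one, sub_zero, mul_one] at this
  simp only [γ, AffineMap.lineMap_apply_zero, AffineMap.lineMap_apply_one] at hle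
  calc _ ≤ _ := hle
    _ ≤ _ := this
    _ = _ := by ring

lemma one_add_dist_div_le {d : ℕ} {ρ : EuclideanSpace ℝ (Fin d) → ℝ} {B₀ k₀ : ℝ}
    (hB₀ : 1 < B₀) (hk₀ : 1 < k₀) (hρ : IsCRF ρ B₀ k₀)
    (hint : ∀ γ : ℝ → EuclideanSpace ℝ (Fin d), ContDiff ℝ 1 γ →
      IntegrableOn (agmonSpeed ρ γ) (Ioo 0 1))
    {x y : EuclideanSpace ℝ (Fin d)} {r : ℝ} (h : agmonDist ρ x y < r) :
    1 + dist x y / ρ x ≤ (1 + B₀ * r) ^ (k₀ + 1) := by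
  obtain ⟨γ, hγ, h0, h1, hlt⟩ := exists_curve_of_agmonDist_lt h
  have hx := hρ.1 x
  have hL := integral_agmonSpeed_nonneg hρ.1 γ
  set L := ∫ t in Ioo 0 1, agmonSpeed ρ γ t with hLdef
  set β := (k₀ + 1)⁻¹ with hβ
  have hβ0 : 0 < β := by positivity
  have hβ1 : β - 1 = -(k₀ / (k₀ + 1)) := by rw [hβ]; field_simp; ring
  have hβle : β ≤ 1 := by
    have : 0 < k₀ / (k₀ + 1) := by positivity
    linarith
  set u : ℝ → ℝ := fun t => dist x (γ t) / ρ x with hu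
  have hu0 : ∀ t, 0 ≤ u t := fun t => div_nonneg dist_nonneg hx.le
  have key : ∀ δ : ℝ, 0 < δ →
      (1 + √(δ ^ 2 + (dist x y / ρ x) ^ 2)) ^ β ≤ (1 + δ) ^ β + B₀ * L := by
    intro δ hδ
    set v : ℝ → ℝ := fun t => √(δ ^ 2 + (‖γ t - x‖ ^ 2) / ρ x ^ 2) with hv
    have huv : ∀ t, v t = √(δ ^ 2 + u t ^ 2) := by
      intro t
      simp only [hv, hu, dist_comm x, dist_eq_norm, div_pow]
    have hle : ∀ t, u t ≤ v t := fun t => by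
      rw [huv]; exact Real.le_sqrt_of_sq_le (by nlinarith)
    have hvpos : ∀ t, 0 < v t := fun t => by rw [huv]; positivity
    have hγd : ∀ t, HasDerivAt γ (deriv γ t) t :=
      fun t => (hγ.differentiable (by simp) t).hasDerivAt
    have hvd : ∀ t, HasDerivAt v
        ((2 * inner ℝ (γ t - x) (deriv γ t) / ρ x ^ 2) / (2 * v t)) t := by
      intro t
      refine HasDerivAt.sqrt ?_ (by positivity)
      exact ((((hγd t).sub_const x).norm_sq).div_const _).const_add _
    set F : ℝ → ℝ := fun t => (1 + v t) ^ β with hF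
    set F' : ℝ → ℝ := fun t =>
      ((2 * inner ℝ (γ t - x) (deriv γ t) / ρ x ^ 2) / (2 * v t)) * β * (1 + v t) ^ (β - 1)
      with hF'
    have hFd : ∀ t, HasDerivAt F (F' t) t := fun t =>
      ((hvd t).const_add 1).rpow_const (Or.inl (by have := hvpos t; positivity))
    have hγc := hγ.continuous
    have hγ'c : Continuous (deriv γ) := hγ.continuous_deriv le_rfl
    have hvc : Continuous v := by
      rw [continuous_iff_continuousAt]; exact fun t => (hvd t).continuousAt
    have hF'c : Continuous F' := by
      refine ((Continuous.div (by fun_prop) (by fun_prop) fun t => ?_).mul continuous_const).mul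
        (Continuous.rpow_const (by fun_prop) fun t => Or.inl ?_)
      · have := hvpos t; positivity
      · have := hvpos t; positivity
    have hbd : ∀ t, F' t ≤ B₀ * agmonSpeed ρ γ t := by
      intro t
      have hv0 := hvpos t
      have e1 : (2 * inner ℝ (γ t - x) (deriv γ t) / ρ x ^ 2) / (2 * v t) ≤
          ‖deriv γ t‖ / ρ x := by
        have hi : inner ℝ (γ t - x) (deriv γ t) ≤ (v t * ρ x) * ‖deriv γ t‖ := by
          refine (real_inner_le_norm _ _).trans (mul_le_mul_of_nonneg_right ?_ (norm_nonneg _))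
          have := hle t
          rw [hu] at this
          simp only [dist_comm x, dist_eq_norm] at this
          exact (div_le_iff₀ hx).1 this
        rw [div_le_div_iff₀ (by positivity) hx, div_mul_eq_mul_div, div_le_iff₀ (by positivity)]
        calc _ ≤ 2 * (v t * ρ x * ‖deriv γ t‖) * ρ x := by gcongr
          _ = _ := by ring
      have e2 : (1 + v t) ^ (β - 1) ≤ (1 + u t) ^ (β - 1) :=
        Real.rpow_le_rpow_of_nonpos (by have := hu0 t; positivity)
          (by linarith [hle t]) (by linarith)
      have e3 : (1 + u t) ^ (β - 1) / ρ x ≤ B₀ * (ρ (γ t))⁻¹ := by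
        have hup := (hρ.2 x (γ t)).2
        have hpos : 0 < 1 + u t := by have := hu0 t; positivity
        rw [hβ1, Real.rpow_neg hpos.le, ← div_eq_mul_inv, div_le_div_iff₀ hx (hρ.1 _),
          inv_mul_le_iff₀ (by positivity)]
        calc _ ≤ _ := hup
          _ = _ := by ring
      have n1 : 0 ≤ (1 + v t) ^ (β - 1) := by positivity
      calc F' t ≤ ‖deriv γ t‖ / ρ x * β * (1 + v t) ^ (β - 1) := by
            simp only [hF']; gcongr
        _ ≤ ‖deriv γ t‖ / ρ x * 1 * (1 + u t) ^ (β - 1) := by gcongr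
        _ = ‖deriv γ t‖ * ((1 + u t) ^ (β - 1) / ρ x) := by ring
        _ ≤ ‖deriv γ t‖ * (B₀ * (ρ (γ t))⁻¹) := by gcongr
        _ = _ := by rw [agmonSpeed]; ring
    have hftc : ∫ t in (0:ℝ)..1, F' t = F 1 - F 0 :=
      intervalIntegral.integral_eq_sub_of_hasDerivAt (fun t _ => hFd t)
        (hF'c.intervalIntegrable _ _)
    have hmono : ∫ t in Ioo (0:ℝ) 1, F' t ≤ ∫ t in Ioo (0:ℝ) 1, B₀ * agmonSpeed ρ γ t :=
      setIntegral_mono ((hF'c.integrableOn_Icc).mono_set Ioo_subset_Icc_self)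
        ((hint γ hγ).const_mul B₀) hbd
    rw [← integral_Ioc_eq_integral_Ioo, ← intervalIntegral.integral_of_le zero_le_one, hftc,
      integral_const_mul, ← hLdef] at hmono
    have f1 : F 1 = (1 + √(δ ^ 2 + (dist x y / ρ x) ^ 2)) ^ β := by
      simp only [hF, huv, hu, h1]
    have f0 : F 0 = (1 + δ) ^ β := by
      simp [hF, huv, hu, h0, Real.sqrt_sq hδ.le]
    linarith
  have hd0 : 0 ≤ dist x y / ρ x := div_nonneg dist_nonneg hx.le
  have hlim : (1 + dist x y / ρ x) ^ β ≤ 1 + B₀ * L := by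
    have ht : Filter.Tendsto (fun δ : ℝ => (1 + δ) ^ β + B₀ * L)
        (nhdsWithin 0 (Ioi 0)) (nhds ((1 + 0) ^ β + B₀ * L)) :=
      (((continuous_const.add continuous_id).rpow_const
        fun _ => Or.inr hβ0.le).add continuous_const).continuousAt.tendsto.mono_left
          nhdsWithin_le_nhds
    have := ge_of_tendsto ht (b := (1 + dist x y / ρ x) ^ β) (by
      filter_upwards [self_mem_nhdsWithin] with δ hδ
      refine le_trans (Real.rpow_le_rpow (by positivity) ?_ hβ0.le) (key δ hδ)
      gcongr
      exact Real.le_sqrt_of_sq_le (by nlinarith [sq_nonneg δ]))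
    simpa using this
  have h3 : (1 + dist x y / ρ x) ^ β ≤ 1 + B₀ * r :=
    hlim.trans (by gcongr)
  have h4 := Real.rpow_le_rpow (by positivity) h3 (show 0 ≤ k₀ + 1 by positivity)
  rwa [← Real.rpow_mul (by positivity), hβ, inv_mul_cancel₀ (by positivity), Real.rpow_one] at h4

lemma exists_rpow_sub_one_le_mul_exp {a A m ε : ℝ} (ha : 0 < a) (hA : 0 < A) (hm : 1 ≤ m)
    (hε : 0 < ε) :
    ∃ K : ℝ, 0 < K ∧ ∀ r : ℝ, 0 < r →
      (1 + a * r) ^ m - 1 ≤ K * min 1 (r / A) * Real.exp (ε * r) := by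
  obtain ⟨η, hη, hηε⟩ : ∃ η : ℝ, 0 < η ∧ η * m + η = ε :=
    ⟨ε / (m + 1), by positivity, by field_simp⟩
  have hlin : ∀ b c r : ℝ, 0 < b → 0 < c → 0 < r →
      b + c * r ≤ (b + c / η) * Real.exp (η * r) := by
    intro b c r hb hc hr
    have h1 := Real.add_one_le_exp (η * r)
    have h2 : 0 < η * r := by positivity
    calc b + c * r = b * 1 + c / η * (η * r) := by field_simp
      _ ≤ b * Real.exp (η * r) + c / η * Real.exp (η * r) := by gcongr <;> linarith
      _ = _ := by ring
  refine ⟨a * m * (1 + a / η) ^ m * (A + 1 / η), by positivity, fun r hr => ?_⟩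
  have hb : 0 < 1 + a * r := by positivity
  have bern : (1 + a * r) ^ m - 1 ≤ a * m * r * (1 + a * r) ^ m := by
    have h := one_add_mul_self_le_rpow_one_add (s := (1 + a * r)⁻¹ - 1)
      (by have := inv_pos.2 hb; linarith) hm
    rw [add_sub_cancel, Real.inv_rpow hb.le] at h
    have e : 1 - a * m * r ≤ 1 + m * ((1 + a * r)⁻¹ - 1) := by
      have : (1 + a * r)⁻¹ - 1 = - (a * r * (1 + a * r)⁻¹) := by field_simp; ring
      have h1 : (1 + a * r)⁻¹ ≤ 1 := inv_le_one_of_one_le₀ (by nlinarith)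
      rw [this]
      have : 0 ≤ m * a * r := by positivity
      nlinarith
    have hP : 0 < (1 + a * r) ^ m := by positivity
    have := mul_le_mul_of_nonneg_right (e.trans h) hP.le
    rw [inv_mul_cancel₀ hP.ne'] at this
    linarith
  have hpow : (1 + a * r) ^ m ≤ (1 + a / η) ^ m * Real.exp (η * r * m) := by
    have h := Real.rpow_le_rpow hb.le (hlin 1 a r one_pos ha hr) (by linarith : 0 ≤ m)
    rwa [Real.mul_rpow (by positivity) (by positivity), ← Real.exp_mul] at h
  have hr' : r ≤ min 1 (r / A) * ((A + 1 / η) * Real.exp (η * r)) := by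
    have h0 : 0 ≤ min 1 (r / A) := by positivity
    refine le_trans ?_ (mul_le_mul_of_nonneg_left (hlin A 1 r hA one_pos hr) h0)
    rcases le_total 1 (r / A) with h | h
    · rw [min_eq_left h]; linarith
    · rw [min_eq_right h, mul_add, div_mul_cancel₀ _ hA.ne']
      have : 0 ≤ r / A * (1 * r) := by positivity
      linarith
  calc _ ≤ _ := bern
    _ ≤ a * m * (min 1 (r / A) * ((A + 1 / η) * Real.exp (η * r))) *
        ((1 + a / η) ^ m * Real.exp (η * r * m)) := by gcongr
    _ = a * m * (1 + a / η) ^ m * (A + 1 / η) * min 1 (r / A) *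
        (Real.exp (η * r) * Real.exp (η * r * m)) := by ring
    _ = _ := by rw [← Real.exp_add, ← hηε]; congr 2; ring

lemma ball_subset_agmonBall {d : ℕ} {ρ : EuclideanSpace ℝ (Fin d) → ℝ} {B₀ k₀ : ℝ}
    (hB₀ : 1 < B₀) (hk₀ : 1 < k₀) (hρ : IsCRF ρ B₀ k₀) (x : EuclideanSpace ℝ (Fin d)) (r : ℝ) :
    ball x (ρ x * min 1 (r / (B₀ * 2 ^ k₀))) ⊆ agmonBall ρ x r := by
  intro y hy
  have hx := hρ.1 x
  rw [mem_ball, dist_comm, ← div_lt_iff₀' hx, lt_min_iff, lt_div_iff₀' (by positivity)] at hy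
  exact (agmonDist_le_of_dist_le hB₀ hk₀ hρ ((div_le_one hx).1 hy.1.le)).trans_lt hy.2

lemma agmonBall_subset_closedBall {d : ℕ} {ρ : EuclideanSpace ℝ (Fin d) → ℝ} {B₀ k₀ : ℝ}
    (hB₀ : 1 < B₀) (hk₀ : 1 < k₀) (hρ : IsCRF ρ B₀ k₀)
    (hint : ∀ γ : ℝ → EuclideanSpace ℝ (Fin d), ContDiff ℝ 1 γ →
      IntegrableOn (agmonSpeed ρ γ) (Ioo 0 1))
    (x : EuclideanSpace ℝ (Fin d)) (r : ℝ) :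
    agmonBall ρ x r ⊆ closedBall x (ρ x * ((1 + B₀ * r) ^ (k₀ + 1) - 1)) := by
  intro y hy
  have h := one_add_dist_div_le hB₀ hk₀ hρ hint hy
  rw [mem_closedBall, dist_comm, ← div_le_iff₀' (hρ.1 x)]
  linarith

lemma isOpen_agmonBall {d : ℕ} {ρ : EuclideanSpace ℝ (Fin d) → ℝ} {B₀ k₀ : ℝ}
    (hB₀ : 1 < B₀) (hk₀ : 1 < k₀) (hρ : IsCRF ρ B₀ k₀)
    (hint : ∀ γ : ℝ → EuclideanSpace ℝ (Fin d), ContDiff ℝ 1 γ →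
      IntegrableOn (agmonSpeed ρ γ) (Ioo 0 1))
    (x : EuclideanSpace ℝ (Fin d)) (r : ℝ) : IsOpen (agmonBall ρ x r) := by
  rw [Metric.isOpen_iff]
  intro y hy
  have hy' : agmonDist ρ x y < r := hy
  have hρy := hρ.1 y
  have hs : 0 < r - agmonDist ρ x y := by linarith
  refine ⟨_, by positivity, (ball_subset_agmonBall hB₀ hk₀ hρ y (r - agmonDist ρ x y)).trans
    fun z hz => ?_⟩
  have hz' : agmonDist ρ y z < r - agmonDist ρ x y := hz
  have := agmonDist_triangle hρ.1 hint x y z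
  change agmonDist ρ x z < r
  linarith

lemma volume_agmonBall_pos {d : ℕ} {ρ : EuclideanSpace ℝ (Fin d) → ℝ} {B₀ k₀ : ℝ}
    (hB₀ : 1 < B₀) (hk₀ : 1 < k₀) (hρ : IsCRF ρ B₀ k₀) (x : EuclideanSpace ℝ (Fin d)) {r : ℝ}
    (hr : 0 < r) : 0 < volume (agmonBall ρ x r) := by
  have := hρ.1 x
  exact (measure_ball_pos volume x (by positivity)).trans_le
    (measure_mono (ball_subset_agmonBall hB₀ hk₀ hρ x r))

lemma volume_agmonBall_lt_top {d : ℕ} {ρ : EuclideanSpace ℝ (Fin d) → ℝ} {B₀ k₀ : ℝ}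
    (hB₀ : 1 < B₀) (hk₀ : 1 < k₀) (hρ : IsCRF ρ B₀ k₀)
    (hint : ∀ γ : ℝ → EuclideanSpace ℝ (Fin d), ContDiff ℝ 1 γ →
      IntegrableOn (agmonSpeed ρ γ) (Ioo 0 1))
    (x : EuclideanSpace ℝ (Fin d)) (r : ℝ) : volume (agmonBall ρ x r) < ∞ :=
  (measure_mono (agmonBall_subset_closedBall hB₀ hk₀ hρ hint x r)).trans_lt
    measure_closedBall_lt_top

lemma exists_volume_agmonBall_three_mul_le {d : ℕ} {ρ : EuclideanSpace ℝ (Fin d) → ℝ} {B₀ k₀ : ℝ}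
    (hB₀ : 1 < B₀) (hk₀ : 1 < k₀) (hρ : IsCRF ρ B₀ k₀)
    (hint : ∀ γ : ℝ → EuclideanSpace ℝ (Fin d), ContDiff ℝ 1 γ →
      IntegrableOn (agmonSpeed ρ γ) (Ioo 0 1)) {ε : ℝ} (hε : 0 < ε) :
    ∃ K : ℝ, 0 < K ∧ ∀ (x : EuclideanSpace ℝ (Fin d)) (r : ℝ), 0 < r →
      volume (agmonBall ρ x (3 * r)) ≤
        ENNReal.ofReal (K * Real.exp (ε * r)) * volume (agmonBall ρ x r) := by
  obtain ⟨K, hK, h⟩ := exists_rpow_sub_one_le_mul_exp (a := 3 * B₀) (A := B₀ * 2 ^ k₀)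
    (m := k₀ + 1) (ε := ε / (d + 1)) (by positivity) (by positivity) (by linarith) (by positivity)
  refine ⟨K ^ d, by positivity, fun x r hr => ?_⟩
  have hx := hρ.1 x
  set s := min 1 (r / (B₀ * 2 ^ k₀)) with hs
  have hs0 : 0 < s := by positivity
  have hR := h r hr
  rw [show 3 * B₀ * r = B₀ * (3 * r) by ring] at hR
  set R := (1 + B₀ * (3 * r)) ^ (k₀ + 1) - 1 with hRdef
  have hR0 : 0 ≤ R := sub_nonneg.2 (Real.one_le_rpow (by
    have : 0 ≤ B₀ * (3 * r) := by positivity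
    linarith) (by linarith))
  have hexp : Real.exp (ε / (d + 1) * r) ^ d ≤ Real.exp (ε * r) := by
    rw [← Real.exp_nat_mul, Real.exp_le_exp]
    have : (d : ℝ) * (ε / (d + 1) * r) = d / (d + 1) * (ε * r) := by ring
    rw [this]
    refine mul_le_of_le_one_left (by positivity) ?_
    rw [div_le_one (by positivity)]
    linarith
  have hreal : (ρ x * R) ^ d ≤ K ^ d * Real.exp (ε * r) * (ρ x * s) ^ d := by
    calc (ρ x * R) ^ d ≤ (ρ x * (K * s * Real.exp (ε / (d + 1) * r))) ^ d := by gcongr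
      _ = K ^ d * Real.exp (ε / (d + 1) * r) ^ d * (ρ x * s) ^ d := by ring
      _ ≤ _ := by gcongr
  calc volume (agmonBall ρ x (3 * r)) ≤ volume (closedBall x (ρ x * R)) :=
        measure_mono (agmonBall_subset_closedBall hB₀ hk₀ hρ hint x (3 * r))
    _ = ENNReal.ofReal ((ρ x * R) ^ d) * volume (ball (0 : EuclideanSpace ℝ (Fin d)) 1) := by
        rw [Measure.addHaar_closedBall _ _ (by positivity), finrank_euclideanSpace_fin]
    _ ≤ ENNReal.ofReal (K ^ d * Real.exp (ε * r) * (ρ x * s) ^ d) *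
        volume (ball (0 : EuclideanSpace ℝ (Fin d)) 1) := by gcongr
    _ = ENNReal.ofReal (K ^ d * Real.exp (ε * r)) * volume (ball x (ρ x * s)) := by
        rw [Measure.addHaar_ball_of_pos volume x (r := ρ x * s) (by positivity),
          finrank_euclideanSpace_fin, ENNReal.ofReal_mul (by positivity), mul_assoc]
    _ ≤ _ := by
        gcongr
        exact ball_subset_agmonBall hB₀ hk₀ hρ x r

/-- For functions on an Agmon ball `B`, the exponentially weighted average over `B` with the larger
constant is dominated by the centered maximal function at every point of `B`. -/
lemma exists_setLIntegral_div_le_aMax {d : ℕ} {ρ : EuclideanSpace ℝ (Fin d) → ℝ} {B₀ k₀ : ℝ}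
    (hB₀ : 1 < B₀) (hk₀ : 1 < k₀) (hρ : IsCRF ρ B₀ k₀)
    (hint : ∀ γ : ℝ → EuclideanSpace ℝ (Fin d), ContDiff ℝ 1 γ →
      IntegrableOn (agmonSpeed ρ γ) (Ioo 0 1)) {c₁ c₂ : ℝ} (hc : 2 * c₂ < c₁) :
    ∃ K : ℝ, 0 < K ∧ ∀ (f : EuclideanSpace ℝ (Fin d) → ℝ) (x : EuclideanSpace ℝ (Fin d)) (r : ℝ),
      0 < r → ∀ y ∈ agmonBall ρ x r,
        (∫⁻ z in agmonBall ρ x r, ENNReal.ofReal |f z|) /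
          (ENNReal.ofReal (K * ((volume (agmonBall ρ x r)).toReal * Real.exp (c₁ * r)))) ≤
        aMax ρ c₂ f y := by
  obtain ⟨K, hK, h⟩ := exists_volume_agmonBall_three_mul_le hB₀ hk₀ hρ hint (sub_pos.2 hc)
  refine ⟨K, hK, fun f x r hr y hy => ?_⟩
  have hxy : agmonDist ρ x y < r := hy
  have hyx : agmonDist ρ y x < r := by rwa [agmonDist_comm hρ.1]
  have hsub : agmonBall ρ x r ⊆ agmonBall ρ y (2 * r) := fun z (hz : agmonDist ρ x z < r) => by
    have := agmonDist_triangle hρ.1 hint y x z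
    change agmonDist ρ y z < 2 * r
    linarith
  have hsup : agmonBall ρ y (2 * r) ⊆ agmonBall ρ x (3 * r) :=
    fun z (hz : agmonDist ρ y z < 2 * r) => by
      have := agmonDist_triangle hρ.1 hint x y z
      change agmonDist ρ x z < 3 * r
      linarith
  refine le_trans ?_ (le_iSup₂_of_le (2 * r) (by positivity : (0 : ℝ) < 2 * r) le_rfl)
  refine ENNReal.div_le_div (lintegral_mono_set hsub) ?_
  calc volume (agmonBall ρ y (2 * r)) * ENNReal.ofReal (Real.exp (c₂ * (2 * r)))
      ≤ (ENNReal.ofReal (K * Real.exp ((c₁ - 2 * c₂) * r)) * volume (agmonBall ρ x r)) *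
          ENNReal.ofReal (Real.exp (c₂ * (2 * r))) := by
        gcongr
        exact (measure_mono hsup).trans (h x r hr)
    _ = _ := by
        rw [← ENNReal.ofReal_toReal (volume_agmonBall_lt_top hB₀ hk₀ hρ hint x r).ne,
          ← ENNReal.ofReal_mul (by positivity), ← ENNReal.ofReal_mul (by positivity),
          ENNReal.toReal_ofReal ENNReal.toReal_nonneg]
        congr 1
        rw [show c₁ * r = (c₁ - 2 * c₂) * r + c₂ * (2 * r) by ring, Real.exp_add]
        ring

lemma volume_agmonBall_eq_top {d : ℕ} {ρ : EuclideanSpace ℝ (Fin d) → ℝ} (hpos : ∀ x, 0 < ρ x)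
    {γ : ℝ → EuclideanSpace ℝ (Fin d)} (hγ : ContDiff ℝ 1 γ)
    (hn : ¬ IntegrableOn (agmonSpeed ρ γ) (Ioo 0 1)) (x : EuclideanSpace ℝ (Fin d)) {r : ℝ}
    (hr : 0 < r) : volume (agmonBall ρ x r) = ∞ := by
  have hu : agmonBall ρ x r = univ :=
    eq_univ_of_forall fun y => (agmonDist_eq_zero hpos hγ hn x y).trans_lt hr
  have : Nontrivial (EuclideanSpace ℝ (Fin d)) := by
    by_contra hsub
    rw [not_nontrivial_iff_subsingleton] at hsub
    refine hn ?_
    have : agmonSpeed ρ γ = fun _ => 0 := by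
      ext t
      rw [agmonSpeed, Subsingleton.elim (deriv γ t) 0, norm_zero, mul_zero]
    rw [this]
    exact integrableOn_zero
  have : NoncompactSpace (EuclideanSpace ℝ (Fin d)) := NormedSpace.noncompactSpace ℝ _
  rw [hu, measure_univ_of_isAddLeftInvariant]

theorem stmt10 {d : ℕ} (ρ : EuclideanSpace ℝ (Fin d) → ℝ) (B₀ k₀ : ℝ)
    (hB₀ : 1 < B₀) (hk₀ : 1 < k₀) (hρ : IsCRF ρ B₀ k₀)
    (p c₁ c₂ : ℝ) (hp : 1 < p) (hc₂ : 0 < c₂) (hc : 2 * c₂ < c₁)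
    (w : EuclideanSpace ℝ (Fin d) → ℝ) (hw : ∀ x, 0 < w x)
    (hbdd : ∃ C : ℝ, 0 < C ∧ ∀ f : EuclideanSpace ℝ (Fin d) → ℝ,
      ∫⁻ x, (aMax ρ c₂ f x) ^ p * ENNReal.ofReal (w x) ≤
        ENNReal.ofReal C * ∫⁻ x, (ENNReal.ofReal |f x|) ^ p * ENNReal.ofReal (w x)) :
    MemS ρ p c₁ w := by
  have hp0 : 0 < p := by linarith
  have hp1 : 0 < p - 1 := by linarith
  by_cases hint : ∀ γ : ℝ → EuclideanSpace ℝ (Fin d), ContDiff ℝ 1 γ →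
      IntegrableOn (agmonSpeed ρ γ) (Ioo 0 1)
  swap
  · push Not at hint
    obtain ⟨γ, hγ, hn⟩ := hint
    refine ⟨0, fun x r hr => ?_⟩
    simp [volume_agmonBall_eq_top hρ.1 hγ hn x hr, hp0.ne']
  obtain ⟨C, hC, hbdd⟩ := hbdd
  obtain ⟨K, hK, hmax⟩ := exists_setLIntegral_div_le_aMax hB₀ hk₀ hρ hint hc
  refine ⟨(C * K ^ p) ^ (1 / p), fun x r hr => ?_⟩
  set B := agmonBall ρ x r with hB
  set σ : EuclideanSpace ℝ (Fin d) → ℝ := fun y => (w y) ^ (-(p - 1)⁻¹) with hσ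
  have hBm : MeasurableSet B := (isOpen_agmonBall hB₀ hk₀ hρ hint x r).measurableSet
  have hV : 0 < (volume B).toReal := ENNReal.toReal_pos
    (volume_agmonBall_pos hB₀ hk₀ hρ x hr).ne' (volume_agmonBall_lt_top hB₀ hk₀ hρ hint x r).ne
  set N := (volume B).toReal * Real.exp (c₁ * r) with hN
  have hN0 : 0 < N := by positivity
  have hσ0 : ∀ y, 0 < σ y := fun y => Real.rpow_pos_of_pos (hw y) _
  have hW0 : 0 ≤ ∫ y in B, w y := integral_nonneg fun y => (hw y).le
  have hS0 : 0 ≤ ∫ y in B, σ y := integral_nonneg fun y => (hσ0 y).le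
  by_cases hwi : IntegrableOn w B
  swap
  · rw [integral_undef hwi, mul_zero, Real.zero_rpow (by positivity), zero_mul]
    positivity
  by_cases hσi : IntegrableOn σ B
  swap
  · rw [integral_undef hσi, mul_zero, Real.zero_rpow (div_pos hp1 hp0).ne', mul_zero]
    positivity
  have eW := ofReal_integral_eq_lintegral_ofReal hwi (ae_of_all _ fun y => (hw y).le)
  have eS := ofReal_integral_eq_lintegral_ofReal hσi (ae_of_all _ fun y => (hσ0 y).le)
  set W := ∫ y in B, w y with hWdef
  set S := ∫ y in B, σ y with hSdef
  set f : EuclideanSpace ℝ (Fin d) → ℝ := B.indicator σ with hf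
  have hfS : ∫⁻ z in B, ENNReal.ofReal |f z| = ENNReal.ofReal S := by
    rw [eS]
    refine setLIntegral_congr_fun hBm fun z hz => ?_
    simp only [hf, indicator_of_mem hz, abs_of_pos (hσ0 z)]
  have hrhs : ∫⁻ z, (ENNReal.ofReal |f z|) ^ p * ENNReal.ofReal (w z) = ENNReal.ofReal S := by
    rw [eS, ← lintegral_indicator hBm]
    refine lintegral_congr fun z => ?_
    by_cases hz : z ∈ B
    · simp only [hf, indicator_of_mem hz, abs_of_pos (hσ0 z)]
      rw [ENNReal.ofReal_rpow_of_pos (hσ0 z),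
        ← ENNReal.ofReal_mul (Real.rpow_nonneg (hσ0 z).le _)]
      congr 1
      simp only [hσ]
      rw [← Real.rpow_mul (hw z).le]
      nth_rewrite 2 [← Real.rpow_one (w z)]
      rw [← Real.rpow_add (hw z)]
      congr 1
      field_simp
      ring
    · simp [hf, indicator_of_notMem hz, hp0]
  have hlhs : ENNReal.ofReal ((S / (K * N)) ^ p * W) ≤
      ∫⁻ z, (aMax ρ c₂ f z) ^ p * ENNReal.ofReal (w z) := by
    calc ENNReal.ofReal ((S / (K * N)) ^ p * W)
        = ∫⁻ z in B, ENNReal.ofReal (S / (K * N)) ^ p * ENNReal.ofReal (w z) := by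
          rw [lintegral_const_mul' _ _ (by finiteness), ← eW,
            ENNReal.ofReal_mul (by positivity), ENNReal.ofReal_rpow_of_nonneg (by positivity) hp0.le]
      _ ≤ ∫⁻ z in B, (aMax ρ c₂ f z) ^ p * ENNReal.ofReal (w z) := by
          refine setLIntegral_mono' hBm fun z hz => ?_
          gcongr
          have := hmax f x r hr z hz
          rwa [← hB, hfS, ← hN, ← ENNReal.ofReal_div_of_pos (by positivity)] at this
      _ ≤ _ := setLIntegral_le_lintegral _ _
  have hmain : (S / (K * N)) ^ p * W ≤ C * S := by
    have h := hlhs.trans (hbdd f)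
    rw [hrhs, ← ENNReal.ofReal_mul hC.le] at h
    exact (ENNReal.ofReal_le_ofReal_iff (by positivity)).1 h
  rcases hS0.eq_or_lt with hS | hS
  · rw [← hS, mul_zero, Real.zero_rpow (div_pos hp1 hp0).ne', mul_zero]
    positivity
  have hfin : (1 / N * W) * (1 / N * S) ^ (p - 1) ≤ C * K ^ p := by
    rw [Real.rpow_sub_one (by positivity)]
    have e : (S / (K * N)) ^ p = (1 / N * S) ^ p / K ^ p := by
      rw [← Real.div_rpow (by positivity) hK.le]
      congr 1
      field_simp
    rw [e, div_mul_eq_mul_div, div_le_iff₀ (by positivity)] at hmain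
    calc 1 / N * W * ((1 / N * S) ^ p / (1 / N * S)) = (1 / N * S) ^ p * W / S := by field_simp
      _ ≤ C * S * K ^ p / S := by gcongr
      _ = C * K ^ p := by field_simp
  calc (1 / N * W) ^ (1 / p) * (1 / N * S) ^ ((p - 1) / p)
      = ((1 / N * W) * (1 / N * S) ^ (p - 1)) ^ (1 / p) := by
        rw [Real.mul_rpow (x := 1 / N * W) (by positivity) (by positivity),
          ← Real.rpow_mul (by positivity), mul_one_div]
    _ ≤ _ := Real.rpow_le_rpow (by positivity) hfin (by positivity)
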